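/- arXiv:2403.16344 — 7 statements merged into one kernel-verified Lean document; each statement's English description precedes it below -/
import Mathlib

section
/- Let z_1,…,z_K > 0 and let 1 ≤ k ≤ K. Then the function p ↦ f_k( log(1 + p_1/z_1), …, log(1 + p_K/z_K) ) is concave on the nonnegative orthant {p ∈ ℝ^K : p_i ≥ 0 for all i}. Consequently, the sum-least-kth-percentile rate maximization problem over parallel Gaussian channels (maximize this function over p ≥ 0 subject to ∑_{i=1}^K p_i ≤ P_T) is a convex program. -/
/-- The sum-greatest-k function `F_k`: the sum of the `k` largest components of `x ∈ ℝ^K`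
(the entries at the top `k` positions of the ascending sort of `x`). -/
noncomputable def sumGreatest (K k : ℕ) (x : Fin K → ℝ) : ℝ :=
  ∑ i ∈ Finset.univ.filter (fun i : Fin K => K - k ≤ (i : ℕ)), x (Tuple.sort x i)

/-- The sum-least-k function `f_k`: the sum of the `k` smallest components of `x ∈ ℝ^K`. -/
noncomputable def sumLeast (K k : ℕ) (x : Fin K → ℝ) : ℝ :=
  ∑ i ∈ Finset.univ.filter (fun i : Fin K => (i : ℕ) < k), x (Tuple.sort x i)
/-- If `y ≤ c` on `A` and `c ≤ y` off `A`, then `A` minimizes the sum of `y` among all finite sets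
of the same cardinality. -/
theorem Finset.sum_le_sum_of_threshold {ι : Type*} [DecidableEq ι] {A T : Finset ι} {y : ι → ℝ}
    {c : ℝ} (hcard : T.card = A.card) (hA : ∀ i ∈ A, y i ≤ c) (hAc : ∀ i ∉ A, c ≤ y i) :
    ∑ i ∈ A, y i ≤ ∑ i ∈ T, y i := by
  have hsdiff : (A \ T).card = (T \ A).card := Finset.card_sdiff_comm hcard.symm
  have hle : ∑ i ∈ A \ T, y i ≤ (A \ T).card • c :=
    Finset.sum_le_card_nsmul _ _ _ fun i hi => hA i (Finset.mem_sdiff.1 hi).1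
  have hge : (T \ A).card • c ≤ ∑ i ∈ T \ A, y i :=
    Finset.card_nsmul_le_sum _ _ _ fun i hi => hAc i (Finset.mem_sdiff.1 hi).2
  rw [← Finset.sum_inter_add_sum_sdiff A T, ← Finset.sum_inter_add_sum_sdiff T A,
    Finset.inter_comm T A]
  rw [hsdiff] at hle
  linarith

theorem card_filter_val_lt {K k : ℕ} (hkK : k ≤ K) :
    (Finset.univ.filter fun i : Fin K => (i : ℕ) < k).card = k := by
  rw [Fin.card_filter_val_lt, min_eq_right hkK]

/-- The sum of the `k` smallest components is at most the sum over any `k` components. -/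
theorem sumLeast_le_sum {K k : ℕ} (hk1 : 1 ≤ k) (hkK : k ≤ K) (x : Fin K → ℝ)
    {S : Finset (Fin K)} (hS : S.card = k) : sumLeast K k x ≤ ∑ i ∈ S, x i := by
  have hmono : Monotone (x ∘ Tuple.sort x) := Tuple.monotone_sort x
  have hsum : ∑ i ∈ S.map (Tuple.sort x).symm.toEmbedding, x (Tuple.sort x i) = ∑ i ∈ S, x i := by
    simp
  rw [← hsum]
  refine Finset.sum_le_sum_of_threshold (c := x (Tuple.sort x ⟨k - 1, by omega⟩)) ?_ ?_ ?_
  · rw [Finset.card_map, hS, card_filter_val_lt hkK]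
  · intro i hi
    have hik : (i : ℕ) < k := (Finset.mem_filter.1 hi).2
    exact hmono (Fin.le_def.2 (by simp only; omega))
  · intro i hi
    have hik : ¬ (i : ℕ) < k := fun h => hi (Finset.mem_filter.2 ⟨Finset.mem_univ i, h⟩)
    exact hmono (Fin.le_def.2 (by simp only; omega))

/-- The sum of the `k` smallest components is attained on some set of `k` indices. -/
theorem exists_sumLeast_eq_sum {K k : ℕ} (hkK : k ≤ K) (x : Fin K → ℝ) :
    ∃ S : Finset (Fin K), S.card = k ∧ sumLeast K k x = ∑ i ∈ S, x i :=
  ⟨(Finset.univ.filter fun i : Fin K => (i : ℕ) < k).map (Tuple.sort x).toEmbedding,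
    by rw [Finset.card_map, card_filter_val_lt hkK], by simp [sumLeast]⟩

/-- The sum of the `k` smallest of finitely many concave functions is concave. -/
theorem ConcaveOn.sumLeast {E : Type*} [AddCommGroup E] [Module ℝ E] {K k : ℕ} (hk1 : 1 ≤ k)
    (hkK : k ≤ K) {s : Set E} (hs : Convex ℝ s) {r : Fin K → E → ℝ}
    (hr : ∀ i, ConcaveOn ℝ s (r i)) : ConcaveOn ℝ s fun p => sumLeast K k fun i => r i p := by
  refine ⟨hs, fun p hp q hq a b ha hb hab => ?_⟩
  obtain ⟨S, hS, hSeq⟩ := exists_sumLeast_eq_sum hkK fun i => r i (a • p + b • q)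
  simp only [smul_eq_mul]
  calc a * _root_.sumLeast K k (fun i => r i p) + b * _root_.sumLeast K k (fun i => r i q)
      ≤ a * ∑ i ∈ S, r i p + b * ∑ i ∈ S, r i q := by
        gcongr <;> exact sumLeast_le_sum hk1 hkK _ hS
    _ = ∑ i ∈ S, (a * r i p + b * r i q) := by
        rw [Finset.sum_add_distrib, Finset.mul_sum, Finset.mul_sum]
    _ ≤ ∑ i ∈ S, r i (a • p + b • q) :=
        Finset.sum_le_sum fun i _ => (hr i).2 hp hq ha hb hab
    _ = _ := hSeq.symm

theorem convex_setOf_forall_nonneg {ι : Type*} : Convex ℝ {p : ι → ℝ | ∀ i, 0 ≤ p i} :=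
  convex_Ici (0 : ι → ℝ)

/-- The rate of a Gaussian channel is a concave function of the transmit powers. -/
theorem concaveOn_log_one_add_div {ι : Type*} {z : ι → ℝ} (hz : ∀ i, 0 < z i) (i : ι) :
    ConcaveOn ℝ {p : ι → ℝ | ∀ i, 0 ≤ p i} fun p => Real.log (1 + p i / z i) := by
  refine ⟨convex_setOf_forall_nonneg, fun p hp q hq a b ha hb hab => ?_⟩
  have hpos : ∀ {p : ι → ℝ}, (∀ i, 0 ≤ p i) → 1 + p i / z i ∈ Set.Ioi (0 : ℝ) := fun hp =>
    add_pos_of_pos_of_nonneg one_pos (div_nonneg (hp i) (hz i).le)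
  convert strictConcaveOn_log_Ioi.concaveOn.2 (hpos hp) (hpos hq) ha hb hab using 2
  simp only [Pi.add_apply, Pi.smul_apply, smul_eq_mul]
  linear_combination -hab

/-- For noise powers z_i > 0 and 1 ≤ k ≤ K, the map
p ↦ f_k(log(1 + p_1/z_1), …, log(1 + p_K/z_K)) is concave on the nonnegative orthant;
consequently (the feasible set {p ≥ 0, ∑ p_i ≤ P_T} being convex), the SLqP rate
maximization problem over parallel Gaussian channels is a convex program. -/
theorem slqp_parallel_gaussian_concave (K k : ℕ) (hk1 : 1 ≤ k) (hkK : k ≤ K)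
    (z : Fin K → ℝ) (hz : ∀ i, 0 < z i) (PT : ℝ) :
    ConcaveOn ℝ {p : Fin K → ℝ | ∀ i, 0 ≤ p i}
      (fun p => sumLeast K k (fun i => Real.log (1 + p i / z i))) ∧
    Convex ℝ {p : Fin K → ℝ | (∀ i, 0 ≤ p i) ∧ ∑ i, p i ≤ PT} := by
  refine ⟨ConcaveOn.sumLeast hk1 hkK convex_setOf_forall_nonneg (concaveOn_log_one_add_div hz),
    convex_setOf_forall_nonneg.inter (convex_halfSpace_le ?_ PT)⟩
  exact ⟨fun p q => by simp [Finset.sum_add_distrib], fun a p => by simp [Finset.mul_sum]⟩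
end

section
/- Let z_1,…,z_K > 0, P_T > 0, r_i(p) = log(1 + p_i/z_i), feasible set 𝒫 = {p ∈ ℝ^K : p ≥ 0, ∑_i p_i ≤ P_T}, and 1 ≤ k ≤ K. If p* ∈ 𝒫 maximizes f_k(r_1(p),…,r_K(p)) over 𝒫, then the K − k + 1 largest achieved rates at p* are all equal: denoting by r^↑_i(p*) the i-th smallest of the rates r_1(p*),…,r_K(p*), one has r^↑_k(p*) = r^↑_{k+1}(p*) = … = r^↑_K(p*). -/
/-- `sumLeast K k` strictly increases from `x` to `y` as soon as every component of `y` exceeds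
the corresponding component of `x` truncated at the `k`-th smallest component of `x`. -/
theorem sumLeast_lt_sumLeast_of_min_lt {K : ℕ} (a : Fin K) (x y : Fin K → ℝ)
    (h : ∀ l, min (x l) (x (Tuple.sort x a)) < y l) :
    sumLeast K (a + 1) x < sumLeast K (a + 1) y := by
  unfold sumLeast
  set σ := Tuple.sort x
  set τ := Tuple.sort y
  set t := x (σ a)
  set F := Finset.univ.filter (fun i : Fin K => (i : ℕ) < a + 1) with hF
  have hmono : Monotone (x ∘ σ) := Tuple.monotone_sort x
  have hlow : ∀ i ∈ F, min (x (σ i)) t = x (σ i) := fun i hi =>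
    min_eq_left (hmono (Fin.le_def.2 (Nat.lt_succ_iff.1 (Finset.mem_filter.1 hi).2)))
  have hhigh : ∀ i ∈ Finset.univ, i ∉ F → min (x (σ i)) t - t = 0 := fun i _ hi => by
    have hai : a ≤ i := by
      simp only [hF, Finset.mem_filter, Finset.mem_univ, true_and] at hi
      exact Fin.le_def.2 (by omega)
    exact sub_eq_zero.2 (min_eq_right (hmono hai))
  have hperm : ∑ i, (min (x (σ i)) t - t) = ∑ i, (min (x (τ i)) t - t) := by
    rw [Equiv.sum_comp σ (fun l => min (x l) t - t), Equiv.sum_comp τ (fun l => min (x l) t - t)]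
  have hsub : ∑ i, (min (x (τ i)) t - t) ≤ ∑ i ∈ F, (min (x (τ i)) t - t) := by
    rw [← Finset.sum_sdiff (Finset.subset_univ F)]
    exact add_le_of_nonpos_left
      (Finset.sum_nonpos fun i _ => sub_nonpos.2 (min_le_right _ _))
  rw [← hperm, ← Finset.sum_subset (Finset.subset_univ F) hhigh, Finset.sum_sub_distrib,
    Finset.sum_sub_distrib, Finset.sum_congr rfl hlow] at hsub
  calc ∑ i ∈ F, x (σ i) ≤ ∑ i ∈ F, min (x (τ i)) t := by linarith
    _ < ∑ i ∈ F, y (τ i) :=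
      Finset.sum_lt_sum_of_nonempty ⟨a, by simp [hF]⟩ fun i _ => h _

/-- If p* is optimal for the SLqP rate maximization problem over parallel
Gaussian channels (1 ≤ k ≤ K), then the K − k + 1 largest achieved rates at p* are all
equal: the i-th smallest rates for i = k, …, K (0-indexed: sorted positions ≥ k − 1)
coincide. -/
theorem slqp_optimal_top_rates_equal (K k : ℕ) (hk1 : 1 ≤ k) (hkK : k ≤ K)
    (z : Fin K → ℝ) (hz : ∀ i, 0 < z i) (PT : ℝ) (hPT : 0 < PT)
    (pstar : Fin K → ℝ) (hfeas : (∀ i, 0 ≤ pstar i) ∧ (∑ i, pstar i) ≤ PT)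
    (hopt : ∀ p : Fin K → ℝ, (∀ i, 0 ≤ p i) → (∑ i, p i) ≤ PT →
      sumLeast K k (fun i => Real.log (1 + p i / z i)) ≤
        sumLeast K k (fun i => Real.log (1 + pstar i / z i))) :
    ∀ i j : Fin K, k - 1 ≤ (i : ℕ) → k - 1 ≤ (j : ℕ) →
      (fun l => Real.log (1 + pstar l / z l))
          (Tuple.sort (fun l => Real.log (1 + pstar l / z l)) i)
        = (fun l => Real.log (1 + pstar l / z l))
          (Tuple.sort (fun l => Real.log (1 + pstar l / z l)) j) := by
  set r : Fin K → ℝ := fun l => Real.log (1 + pstar l / z l)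
  obtain ⟨hp0, hpsum⟩ := hfeas
  have hK : 0 < K := by omega
  let a : Fin K := ⟨k - 1, by omega⟩
  have hak : (a : ℕ) + 1 = k := by simp only [a]; omega
  set t := r (Tuple.sort r a)
  have ht0 : 0 ≤ t :=
    Real.log_nonneg (le_add_of_nonneg_right (div_nonneg (hp0 _) (hz _).le))
  suffices hle : ∀ m, r m ≤ t by
    have heq : ∀ i : Fin K, k - 1 ≤ (i : ℕ) → r (Tuple.sort r i) = t := fun i hi =>
      (hle _).antisymm (Tuple.monotone_sort r (Fin.le_def.2 hi : a ≤ i))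
    intro i j hi hj
    exact (heq i hi).trans (heq j hj).symm
  intro m
  by_contra! hm
  have hpos : ∀ l, 0 < 1 + pstar l / z l := fun l =>
    add_pos_of_pos_of_nonneg one_pos (div_nonneg (hp0 l) (hz l).le)
  set q := z m * (Real.exp t - 1) with hq
  have hq0 : 0 ≤ q := mul_nonneg (hz m).le (sub_nonneg.2 (Real.one_le_exp ht0))
  have hqp : q < pstar m := by
    have h1 : Real.exp t - 1 < pstar m / z m := by
      linarith [(Real.lt_log_iff_exp_lt (hpos m)).1 hm]
    rw [lt_div_iff₀ (hz m)] at h1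
    linarith
  have hKR : (0 : ℝ) < K := Nat.cast_pos.2 hK
  obtain ⟨δ, hδ, hKδ⟩ : ∃ δ : ℝ, 0 < δ ∧ K * δ = (pstar m - q) / 2 :=
    ⟨(pstar m - q) / 2 / K, div_pos (by linarith) hKR, mul_div_cancel₀ _ hKR.ne'⟩
  let p : Fin K → ℝ := fun l => pstar l + δ - if l = m then K * δ else 0
  have hpm : q < p m := by simp only [p, if_true]; linarith
  have hpl : ∀ l, l ≠ m → pstar l < p l := fun l hl => by simp [p, hl, hδ]
  have hpnn : ∀ l, 0 ≤ p l := fun l => by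
    rcases eq_or_ne l m with rfl | hl
    · exact hq0.trans hpm.le
    · exact (hp0 l).trans (hpl l hl).le
  have hsum : ∑ l, p l = ∑ l, pstar l := by
    simp [p, Finset.sum_sub_distrib, Finset.sum_add_distrib]
  refine (hopt p hpnn (hsum.trans_le hpsum)).not_gt ?_
  rw [← hak]
  refine sumLeast_lt_sumLeast_of_min_lt a r _ fun l => ?_
  rcases eq_or_ne l m with rfl | hl
  · refine (min_le_right _ _).trans_lt ((Real.lt_log_iff_exp_lt ?_).2 ?_)
    · exact add_pos_of_pos_of_nonneg one_pos (div_nonneg (hpnn l) (hz l).le)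
    · have h1 : Real.exp t - 1 < p l / z l := by
        rw [lt_div_iff₀ (hz l)]
        linarith
      linarith
  · refine (min_le_left _ _).trans_lt (Real.log_lt_log (hpos l) ?_)
    have := div_lt_div_of_pos_right (hpl l hl) (hz l)
    linarith
end

section
/- Consider the least-k-th-percentile (LqP) rate maximization over parallel Gaussian channels: maximize f_k(r(p)) − f_{k−1}(r(p)) (the k-th smallest rate) over p ≥ 0 with ∑_i p_i ≤ P_T, where r_i(p) = log(1 + p_i/z_i), the noise powers are ordered z_1 ≥ z_2 ≥ … ≥ z_K > 0, and 2 ≤ k ≤ K. Then for every feasible p there exists a feasible p′ with p′_1 = p′_2 = … = p′_{k−1} = 0 (hence r_1(p′) = … = r_{k−1}(p′) = 0) whose LqP objective value is at least that of p; in particular, the optimal value of the LqP problem equals the optimal value of the max-min problem maximize min_{i = k,…,K} r_i(p) over the same feasible set. -/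
/-- The difference of consecutive sum-least functions is the corresponding order statistic. -/
lemma sumLeast_succ_sub (K m : ℕ) (hm : m < K) (x : Fin K → ℝ) :
    sumLeast K (m + 1) x - sumLeast K m x = x (Tuple.sort x ⟨m, hm⟩) := by
  have h : Finset.univ.filter (fun i : Fin K => (i : ℕ) < m + 1) =
      insert ⟨m, hm⟩ (Finset.univ.filter (fun i : Fin K => (i : ℕ) < m)) := by
    ext i
    simp only [Finset.mem_filter, Finset.mem_univ, true_and, Finset.mem_insert, Fin.ext_iff]
    omega
  rw [sumLeast, sumLeast, h, Finset.sum_insert (by simp)]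
  ring

/-- A lower bound for all entries at positions `≥ m` bounds the `m`-th order statistic. -/
lemma le_apply_sort {K m : ℕ} (hm : m < K) {x : Fin K → ℝ} {v : ℝ}
    (h : ∀ i : Fin K, m ≤ (i : ℕ) → v ≤ x i) : v ≤ x (Tuple.sort x ⟨m, hm⟩) := by
  obtain ⟨j, hj, hjm⟩ : ∃ j : Fin K, (j : ℕ) ≤ m ∧ m ≤ (Tuple.sort x j : ℕ) := by
    by_contra! hc
    have hcard := Finset.card_le_card_of_injOn (s := Finset.Iic (⟨m, hm⟩ : Fin K))
      (t := Finset.Iio (⟨m, hm⟩ : Fin K)) (Tuple.sort x)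
      (fun j hj => by
        have := hc j (by simpa [Fin.le_def] using hj)
        simpa [Fin.lt_def] using this)
      (Tuple.sort x).injective.injOn
    simp at hcard
  exact (h _ hjm).trans (Tuple.monotone_sort x (show j ≤ ⟨m, hm⟩ from hj))

/-- The tail sum of an antitone sequence is minimal among its rearrangements. -/
lemma Antitone.sum_tail_le_sum_tail_comp_perm {K : ℕ} (m : ℕ) {z : Fin K → ℝ} (hz : Antitone z)
    (σ : Equiv.Perm (Fin K)) :
    ∑ i : Fin K, (if m ≤ (i : ℕ) then z i else 0) ≤
      ∑ i : Fin K, if m ≤ (i : ℕ) then z (σ i) else 0 := by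
  have hf : Monotone (fun i : Fin K => if m ≤ (i : ℕ) then (1 : ℝ) else 0) := by
    intro i j hij
    have : (i : ℕ) ≤ j := hij
    dsimp only
    split_ifs <;> first | omega | norm_num
  simpa using (hf.antivary hz).sum_smul_le_sum_smul_comp_perm (σ := σ)

/-- The powers giving rate `v` to exactly the users at positions `≥ m` are feasible whenever
`v` is the `m`-th order statistic of the rates of a feasible power vector. -/
lemma sum_equalizing_power_le {K m : ℕ} (hm : m < K) {z p : Fin K → ℝ} (hz : ∀ i, 0 < z i)
    (hanti : Antitone z) (hp : ∀ i, 0 ≤ p i) {v : ℝ} (hv : 0 ≤ v)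
    (hvp : v ≤ Real.log (1 + p (Tuple.sort (fun i => Real.log (1 + p i / z i)) ⟨m, hm⟩) /
      z (Tuple.sort (fun i => Real.log (1 + p i / z i)) ⟨m, hm⟩))) :
    ∑ i : Fin K, (if m ≤ (i : ℕ) then (Real.exp v - 1) * z i else 0) ≤ ∑ i, p i := by
  set r : Fin K → ℝ := fun i => Real.log (1 + p i / z i) with hr
  have hc : 0 ≤ Real.exp v - 1 := sub_nonneg.2 (Real.one_le_exp hv)
  calc ∑ i : Fin K, (if m ≤ (i : ℕ) then (Real.exp v - 1) * z i else 0)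
      = (Real.exp v - 1) * ∑ i : Fin K, (if m ≤ (i : ℕ) then z i else 0) := by
        simp [Finset.mul_sum]
    _ ≤ (Real.exp v - 1) * ∑ i : Fin K, (if m ≤ (i : ℕ) then z (Tuple.sort r i) else 0) :=
        mul_le_mul_of_nonneg_left (hanti.sum_tail_le_sum_tail_comp_perm m _) hc
    _ = ∑ i : Fin K, (if m ≤ (i : ℕ) then (Real.exp v - 1) * z (Tuple.sort r i) else 0) := by
        simp [Finset.mul_sum]
    _ ≤ ∑ i, p (Tuple.sort r i) := by
        refine Finset.sum_le_sum fun i _ => ?_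
        split_ifs with hi
        · have h : v ≤ Real.log (1 + p (Tuple.sort r i) / z (Tuple.sort r i)) :=
            hvp.trans (Tuple.monotone_sort r (show (⟨m, hm⟩ : Fin K) ≤ i from hi))
          have hpos : 0 < 1 + p (Tuple.sort r i) / z (Tuple.sort r i) := by
            have := div_nonneg (hp (Tuple.sort r i)) (hz (Tuple.sort r i)).le
            linarith
          rw [Real.le_log_iff_exp_le hpos] at h
          rw [← le_div_iff₀ (hz _)]
          linarith
        · exact hp _
    _ = ∑ i, p i := Equiv.sum_comp _ p

/-- Least-k-th-percentile (LqP) rate maximization over parallel Gaussian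
channels, with noise powers ordered z_1 ≥ … ≥ z_K > 0 and 2 ≤ k ≤ K. The objective is
the k-th smallest rate, f_k(r(p)) − f_{k−1}(r(p)). (1) For every feasible p there is a
feasible p′ with p′_1 = … = p′_{k−1} = 0 whose objective value is at least that of p;
(2) the optimal LqP value equals the optimal value of maximizing min_{i = k,…,K} r_i(p). -/
theorem lqp_zero_weakest_users (K k : ℕ) (hk2 : 2 ≤ k) (hkK : k ≤ K)
    (z : Fin K → ℝ) (hz : ∀ i, 0 < z i) (hzord : ∀ i j : Fin K, i ≤ j → z j ≤ z i)
    (PT : ℝ) (hPT : 0 < PT) :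
    (∀ p : Fin K → ℝ, (∀ i, 0 ≤ p i) → (∑ i, p i) ≤ PT →
      ∃ p' : Fin K → ℝ, (∀ i, 0 ≤ p' i) ∧ (∑ i, p' i) ≤ PT ∧
        (∀ i : Fin K, (i : ℕ) < k - 1 → p' i = 0) ∧
        sumLeast K k (fun i => Real.log (1 + p i / z i))
            - sumLeast K (k - 1) (fun i => Real.log (1 + p i / z i))
          ≤ sumLeast K k (fun i => Real.log (1 + p' i / z i))
            - sumLeast K (k - 1) (fun i => Real.log (1 + p' i / z i))) ∧
    sSup {v : ℝ | ∃ p : Fin K → ℝ, (∀ i, 0 ≤ p i) ∧ (∑ i, p i) ≤ PT ∧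
        v = sumLeast K k (fun i => Real.log (1 + p i / z i))
            - sumLeast K (k - 1) (fun i => Real.log (1 + p i / z i))}
      = sSup {v : ℝ | ∃ p : Fin K → ℝ, (∀ i, 0 ≤ p i) ∧ (∑ i, p i) ≤ PT ∧
        v = ⨅ i : {i : Fin K // k - 1 ≤ (i : ℕ)}, Real.log (1 + p i.1 / z i.1)} := by
  obtain ⟨m, rfl⟩ : ∃ m, k = m + 1 := ⟨k - 1, by omega⟩
  have hm : m < K := hkK
  simp only [Nat.add_sub_cancel, sumLeast_succ_sub K m hm]
  have hanti : Antitone z := fun i j => hzord i j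
  have hrate : ∀ p : Fin K → ℝ, (∀ i, 0 ≤ p i) → ∀ i, 0 ≤ Real.log (1 + p i / z i) :=
    fun p hp i => Real.log_nonneg (by linarith [div_nonneg (hp i) (hz i).le])
  have key : ∀ p : Fin K → ℝ, (∀ i, 0 ≤ p i) → (∑ i, p i) ≤ PT →
      ∃ p' : Fin K → ℝ, (∀ i, 0 ≤ p' i) ∧ (∑ i, p' i) ≤ PT ∧
        (∀ i : Fin K, (i : ℕ) < m → p' i = 0) ∧
        ∀ i : Fin K, m ≤ (i : ℕ) →
          (fun i => Real.log (1 + p i / z i))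
            (Tuple.sort (fun i => Real.log (1 + p i / z i)) ⟨m, hm⟩)
          ≤ Real.log (1 + p' i / z i) := by
    intro p hp hsum
    obtain ⟨v, hv⟩ : ∃ v, v = (fun i => Real.log (1 + p i / z i))
      (Tuple.sort (fun i => Real.log (1 + p i / z i)) ⟨m, hm⟩) := ⟨_, rfl⟩
    have hv0 : 0 ≤ v := hv ▸ hrate p hp _
    have hc : 0 ≤ Real.exp v - 1 := sub_nonneg.2 (Real.one_le_exp hv0)
    refine ⟨fun i => if m ≤ (i : ℕ) then (Real.exp v - 1) * z i else 0, fun i => ?_,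
      (sum_equalizing_power_le hm hz hanti hp hv0 hv.le).trans hsum,
      fun i hi => if_neg (not_le.2 hi), fun i hi => ?_⟩
    · dsimp only
      split_ifs
      · exact mul_nonneg hc (hz i).le
      · exact le_rfl
    · rw [← hv]
      simp only [if_pos hi]
      rw [mul_div_cancel_right₀ _ (hz i).ne', add_sub_cancel, Real.log_exp]
  have hinf : ∀ p : Fin K → ℝ,
      (⨅ i : {i : Fin K // m ≤ (i : ℕ)}, Real.log (1 + p i.1 / z i.1)) ≤
        (fun i => Real.log (1 + p i / z i))
          (Tuple.sort (fun i => Real.log (1 + p i / z i)) ⟨m, hm⟩) := fun p =>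
    le_apply_sort (x := fun i => Real.log (1 + p i / z i)) hm fun i hi =>
      ciInf_le (f := fun i : {i : Fin K // m ≤ (i : ℕ)} => Real.log (1 + p i.1 / z i.1))
        (Set.finite_range _).bddBelow ⟨i, hi⟩
  have hbdd : ∀ p : Fin K → ℝ, (∀ i, 0 ≤ p i) → (∑ i, p i) ≤ PT →
      ∀ i, Real.log (1 + p i / z i) ≤ PT / z ⟨K - 1, by omega⟩ := by
    intro p hp hsum i
    have h0 := div_nonneg (hp i) (hz i).le
    have hpi : p i ≤ PT :=
      (Finset.single_le_sum (fun j _ => hp j) (Finset.mem_univ i)).trans hsum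
    have hzi : z ⟨K - 1, by omega⟩ ≤ z i := hzord _ _ (Fin.le_def.2 (by dsimp only; omega))
    calc Real.log (1 + p i / z i) ≤ p i / z i := by
          linarith [Real.log_le_sub_one_of_pos (show 0 < 1 + p i / z i by linarith)]
      _ ≤ PT / z ⟨K - 1, by omega⟩ := div_le_div₀ hPT.le hpi (hz _) hzi
  have : Nonempty {i : Fin K // m + 1 - 1 ≤ (i : ℕ)} := ⟨⟨⟨m, hm⟩, le_rfl⟩⟩
  refine ⟨fun p hp hsum => ?_, le_antisymm ?_ ?_⟩
  · obtain ⟨p', hp', hsum', hzero, hle⟩ := key p hp hsum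
    exact ⟨p', hp', hsum', hzero, le_apply_sort hm hle⟩
  · refine csSup_le ⟨_, 0, fun _ => le_rfl, by simpa using hPT.le, rfl⟩ ?_
    rintro _ ⟨p, hp, hsum, rfl⟩
    obtain ⟨p', hp', hsum', -, hle⟩ := key p hp hsum
    refine le_csSup_of_le ⟨PT / z ⟨K - 1, by omega⟩, ?_⟩ ⟨p', hp', hsum', rfl⟩
      (le_ciInf fun i => hle i.1 i.2)
    rintro _ ⟨q, hq, hqsum, rfl⟩
    exact (hinf q).trans (hbdd q hq hqsum _)
  · refine csSup_le ⟨_, 0, fun _ => le_rfl, by simpa using hPT.le, rfl⟩ ?_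
    rintro _ ⟨p, hp, hsum, rfl⟩
    refine le_csSup_of_le ⟨PT / z ⟨K - 1, by omega⟩, ?_⟩ ⟨p, hp, hsum, rfl⟩ (hinf p)
    rintro _ ⟨q, hq, hqsum, rfl⟩
    exact hbdd q hq hqsum _
end

section
/- (Quadratic fractional transform, optimization form.) Let 𝒫 ⊆ ℝ^K be nonempty, and let A : 𝒫 → ℝ with A(p) ≥ 0 for all p and B : 𝒫 → ℝ with B(p) > 0 for all p. Then sup_{p ∈ 𝒫} A(p)/B(p) = sup_{p ∈ 𝒫, x ∈ ℝ} ( 2x√(A(p)) − x² B(p) ); moreover, for each fixed p the inner supremum over x is attained at x = √(A(p))/B(p), and p* maximizes A(p)/B(p) over 𝒫 if and only if (x*, p*) with x* = √(A(p*))/B(p*) maximizes the auxiliary objective. -/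
/-- Completing the square: the quadratic transform never exceeds the ratio. -/
theorem two_mul_mul_sqrt_sub_sq_mul_le_div {a b : ℝ} (ha : 0 ≤ a) (hb : 0 < b) (x : ℝ) :
    2 * x * Real.sqrt a - x ^ 2 * b ≤ a / b := by
  rw [le_div_iff₀ hb]
  nlinarith [sq_nonneg (x * b - Real.sqrt a), Real.sq_sqrt ha]

/-- The quadratic transform equals the ratio at `x = √a / b`. -/
theorem two_mul_mul_sqrt_sub_sq_mul_eq_div {a b : ℝ} (ha : 0 ≤ a) (hb : 0 < b) :
    2 * (Real.sqrt a / b) * Real.sqrt a - (Real.sqrt a / b) ^ 2 * b = a / b := by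
  have hb' := hb.ne'
  field_simp
  linarith [Real.sq_sqrt ha]

/-- Quadratic fractional transform, optimization form: for nonempty
𝒫 ⊆ ℝ^K, A ≥ 0 and B > 0 on 𝒫, sup_{p} A(p)/B(p) = sup_{p,x} (2x√(A(p)) − x²B(p)); for
each fixed p the inner supremum over x is attained at x = √(A(p))/B(p); and p* maximizes
A/B over 𝒫 iff (x*, p*) with x* = √(A(p*))/B(p*) maximizes the auxiliary objective. -/
theorem quadratic_fractional_transform_opt (K : ℕ) (P : Set (Fin K → ℝ)) (hP : P.Nonempty)
    (A B : (Fin K → ℝ) → ℝ) (hA : ∀ p ∈ P, 0 ≤ A p) (hB : ∀ p ∈ P, 0 < B p) :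
    sSup {v : ℝ | ∃ p ∈ P, v = A p / B p}
      = sSup {v : ℝ | ∃ p ∈ P, ∃ x : ℝ, v = 2 * x * Real.sqrt (A p) - x ^ 2 * B p} ∧
    (∀ p ∈ P,
      IsGreatest {v : ℝ | ∃ x : ℝ, v = 2 * x * Real.sqrt (A p) - x ^ 2 * B p} (A p / B p) ∧
      2 * (Real.sqrt (A p) / B p) * Real.sqrt (A p) - (Real.sqrt (A p) / B p) ^ 2 * B p
        = A p / B p) ∧
    (∀ pstar ∈ P,
      ((∀ q ∈ P, A q / B q ≤ A pstar / B pstar) ↔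
        (∀ q ∈ P, ∀ x : ℝ, 2 * x * Real.sqrt (A q) - x ^ 2 * B q ≤
          2 * (Real.sqrt (A pstar) / B pstar) * Real.sqrt (A pstar)
            - (Real.sqrt (A pstar) / B pstar) ^ 2 * B pstar))) := by
  have le (p) (hp : p ∈ P) := two_mul_mul_sqrt_sub_sq_mul_le_div (hA p hp) (hB p hp)
  have eq (p) (hp : p ∈ P) := two_mul_mul_sqrt_sub_sq_mul_eq_div (hA p hp) (hB p hp)
  refine ⟨csSup_eq_csSup_of_forall_exists_le ?_ ?_, fun p hp => ⟨⟨⟨_, (eq p hp).symm⟩, ?_⟩, eq p hp⟩,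
    fun p hp => ?_⟩
  · rintro _ ⟨p, hp, rfl⟩
    exact ⟨_, ⟨p, hp, _, rfl⟩, (eq p hp).ge⟩
  · rintro _ ⟨p, hp, x, rfl⟩
    exact ⟨_, ⟨p, hp, rfl⟩, le p hp x⟩
  · rintro _ ⟨x, rfl⟩
    exact le p hp x
  · rw [eq p hp]
    exact ⟨fun h q hq x => (le q hq x).trans (h q hq), fun h q hq => (eq q hq).ge.trans (h q hq _)⟩
end

section
/- (QFT equivalence for SLqP rate maximization.) Let 𝒫 ⊆ ℝ^K be nonempty, let 1 ≤ k ≤ K, and for each i = 1,…,K let A_i : 𝒫 → ℝ be nonnegative-valued and B_i : 𝒫 → ℝ be positive-valued. Then sup_{p ∈ 𝒫} f_k( log(1 + A_1(p)/B_1(p)), …, log(1 + A_K(p)/B_K(p)) ) = sup over p ∈ 𝒫 and x ∈ ℝ^K satisfying 1 + 2x_i√(A_i(p)) − x_i² B_i(p) > 0 for all i, of f_k( log(1 + 2x_1√(A_1(p)) − x_1² B_1(p)), …, log(1 + 2x_K√(A_K(p)) − x_K² B_K(p)) ); moreover, for each fixed p the inner supremum over x is attained at x_i = √(A_i(p))/B_i(p),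 where it equals f_k of the original rates at p. -/
theorem sumLeast_eq_sum_mul (K k : ℕ) (x : Fin K → ℝ) :
    sumLeast K k x = ∑ i : Fin K, (if (i : ℕ) < k then (1 : ℝ) else 0) * x (Tuple.sort x i) := by
  simp [sumLeast, Finset.sum_filter]

/-- The sorted arrangement minimizes the sum over the first `k` positions, by the
rearrangement inequality. -/
theorem sumLeast_le_sum_comp_perm (K k : ℕ) (x : Fin K → ℝ) (σ : Equiv.Perm (Fin K)) :
    sumLeast K k x ≤ ∑ i ∈ Finset.univ.filter (fun i : Fin K => (i : ℕ) < k), x (σ i) := by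
  have hc : Antitone (fun i : Fin K => if (i : ℕ) < k then (1 : ℝ) else 0) := by
    intro i j hij
    have hij' : (i : ℕ) ≤ j := hij
    dsimp only
    split_ifs <;> first | omega | norm_num
  have h := (hc.antivary (Tuple.monotone_sort x)).sum_mul_le_sum_mul_comp_perm
    (σ := (Tuple.sort x)⁻¹ * σ)
  rw [sumLeast_eq_sum_mul]
  simpa [Finset.sum_filter] using h

theorem sumLeast_mono (K k : ℕ) : Monotone (sumLeast K k) := fun x y hxy =>
  (sumLeast_le_sum_comp_perm K k x (Tuple.sort y)).trans
    (Finset.sum_le_sum fun i _ => hxy (Tuple.sort y i))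

/-- At `x = √a / b` the quadratic transform equals the ratio it replaces. -/
theorem quadratic_transform_eq {a b : ℝ} (ha : 0 ≤ a) (hb : 0 < b) :
    1 + 2 * (Real.sqrt a / b) * Real.sqrt a - (Real.sqrt a / b) ^ 2 * b = 1 + a / b := by
  have hs := Real.sq_sqrt ha
  field_simp
  linear_combination hs

/-- The quadratic transform is a lower bound for the ratio it replaces. -/
theorem quadratic_transform_le {a b : ℝ} (ha : 0 ≤ a) (hb : 0 < b) (x : ℝ) :
    1 + 2 * x * Real.sqrt a - x ^ 2 * b ≤ 1 + a / b := by
  have hs := Real.sq_sqrt ha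
  have h : 2 * x * Real.sqrt a - x ^ 2 * b ≤ a / b := by
    rw [le_div_iff₀ hb]
    nlinarith [sq_nonneg (x * b - Real.sqrt a)]
  linarith

/-- QFT equivalence for SLqP rate maximization: for nonempty 𝒫 ⊆ ℝ^K,
1 ≤ k ≤ K, and signal/interference-plus-noise powers A_i ≥ 0, B_i > 0 on 𝒫, the supremum
of f_k of the original rates over 𝒫 equals the supremum of f_k of the QFT auxiliary rates
over p ∈ 𝒫 and x ∈ ℝ^K with 1 + 2x_i√(A_i(p)) − x_i²B_i(p) > 0 for all i; moreover for
each fixed p the inner supremum over x is attained at x_i = √(A_i(p))/B_i(p), where it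
equals f_k of the original rates at p. -/
theorem qft_slqp_equivalence (K k : ℕ) (hk1 : 1 ≤ k) (hkK : k ≤ K)
    (P : Set (Fin K → ℝ)) (hP : P.Nonempty)
    (A B : Fin K → (Fin K → ℝ) → ℝ)
    (hA : ∀ i, ∀ p ∈ P, 0 ≤ A i p) (hB : ∀ i, ∀ p ∈ P, 0 < B i p) :
    sSup {v : ℝ | ∃ p ∈ P,
        v = sumLeast K k (fun i => Real.log (1 + A i p / B i p))}
      = sSup {v : ℝ | ∃ p ∈ P, ∃ x : Fin K → ℝ,
          (∀ i, 0 < 1 + 2 * x i * Real.sqrt (A i p) - (x i) ^ 2 * B i p) ∧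
          v = sumLeast K k (fun i =>
            Real.log (1 + 2 * x i * Real.sqrt (A i p) - (x i) ^ 2 * B i p))} ∧
    ∀ p ∈ P,
      (∀ i, 0 < 1 + 2 * (Real.sqrt (A i p) / B i p) * Real.sqrt (A i p)
          - (Real.sqrt (A i p) / B i p) ^ 2 * B i p) ∧
      sumLeast K k (fun i => Real.log (1 + 2 * (Real.sqrt (A i p) / B i p) * Real.sqrt (A i p)
          - (Real.sqrt (A i p) / B i p) ^ 2 * B i p))
        = sumLeast K k (fun i => Real.log (1 + A i p / B i p)) ∧
      ∀ x : Fin K → ℝ,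
        (∀ i, 0 < 1 + 2 * x i * Real.sqrt (A i p) - (x i) ^ 2 * B i p) →
        sumLeast K k (fun i =>
            Real.log (1 + 2 * x i * Real.sqrt (A i p) - (x i) ^ 2 * B i p))
          ≤ sumLeast K k (fun i => Real.log (1 + A i p / B i p)) := by
  have heq : ∀ p ∈ P, ∀ i, 1 + 2 * (Real.sqrt (A i p) / B i p) * Real.sqrt (A i p)
      - (Real.sqrt (A i p) / B i p) ^ 2 * B i p = 1 + A i p / B i p :=
    fun p hp i => quadratic_transform_eq (hA i p hp) (hB i p hp)
  have hpos : ∀ p ∈ P, ∀ i, 0 < 1 + A i p / B i p := fun p hp i =>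
    add_pos_of_pos_of_nonneg one_pos (div_nonneg (hA i p hp) (hB i p hp).le)
  have hle : ∀ p ∈ P, ∀ x : Fin K → ℝ,
      (∀ i, 0 < 1 + 2 * x i * Real.sqrt (A i p) - (x i) ^ 2 * B i p) →
      sumLeast K k (fun i =>
          Real.log (1 + 2 * x i * Real.sqrt (A i p) - (x i) ^ 2 * B i p))
        ≤ sumLeast K k (fun i => Real.log (1 + A i p / B i p)) := fun p hp x hx =>
    sumLeast_mono K k fun i =>
      Real.log_le_log (hx i) (quadratic_transform_le (hA i p hp) (hB i p hp) (x i))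
  refine ⟨csSup_eq_csSup_of_forall_exists_le ?_ ?_, fun p hp => ⟨fun i => ?_, ?_, hle p hp⟩⟩
  · rintro _ ⟨p, hp, rfl⟩
    refine ⟨_, ⟨p, hp, fun i => Real.sqrt (A i p) / B i p, fun i => ?_, rfl⟩, ?_⟩
    · rw [heq p hp i]
      exact hpos p hp i
    · simp only [heq p hp, le_refl]
  · rintro _ ⟨p, hp, x, hx, rfl⟩
    exact ⟨_, ⟨p, hp, rfl⟩, hle p hp x hx⟩
  · rw [heq p hp i]
    exact hpos p hp i
  · simp only [heq p hp]
end

section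
/- (LFT equivalence for SLqP rate maximization.) Let 𝒫 ⊆ ℝ^K be nonempty, let 1 ≤ k ≤ K, and for each i = 1,…,K let A_i : 𝒫 → ℝ be nonnegative-valued and B_i : 𝒫 → ℝ be positive-valued. Then sup_{p ∈ 𝒫} f_k( log(1 + A_1(p)/B_1(p)), …, log(1 + A_K(p)/B_K(p)) ) = sup over p ∈ 𝒫 and x ∈ ℝ^K with x_i > 0 for all i, of f_k( ř_1(x_1,p), …, ř_K(x_K,p) ), where ř_i(x_i,p) = −x_i B_i(p) + log( x_i (A_i(p) + B_i(p)) ) + 1; moreover, for each fixed p the inner supremum over x is attained at x_i = 1/B_i(p), where it equals f_k of the original rates at p. -/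
theorem Equiv.Perm.exists_le_apply {n : ℕ} (σ : Equiv.Perm (Fin n)) (i : Fin n) :
    ∃ j ≤ i, i ≤ σ j := by
  by_contra! h
  have hcard := Finset.card_le_card_of_injOn (s := Finset.Iic i) (t := Finset.Iio i) σ
    (fun j hj => by simpa using h j (by simpa using hj)) σ.injective.injOn
  simp at hcard

theorem Tuple.apply_sort_mono {n : ℕ} {α : Type*} [LinearOrder α] {x y : Fin n → α}
    (h : x ≤ y) (i : Fin n) : x (Tuple.sort x i) ≤ y (Tuple.sort y i) := by
  obtain ⟨j, hji, hij⟩ := Equiv.Perm.exists_le_apply ((Tuple.sort y).trans (Tuple.sort x).symm) i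
  calc x (Tuple.sort x i)
      ≤ x (Tuple.sort x ((Tuple.sort x).symm (Tuple.sort y j))) := Tuple.monotone_sort x hij
    _ = x (Tuple.sort y j) := by rw [Equiv.apply_symm_apply]
    _ ≤ y (Tuple.sort y j) := h _
    _ ≤ y (Tuple.sort y i) := Tuple.monotone_sort y hji

theorem neg_mul_add_log_add_one_le {a b t : ℝ} (ha : 0 ≤ a) (hb : 0 < b) (ht : 0 < t) :
    -t * b + Real.log (t * (a + b)) + 1 ≤ Real.log (1 + a / b) := by
  have hsplit : t * (a + b) = t * b * (1 + a / b) := by field_simp; ring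
  rw [hsplit, Real.log_mul (by positivity) (by positivity)]
  linarith [Real.log_le_sub_one_of_pos (mul_pos ht hb)]

theorem neg_one_div_mul_add_log_add_one {a b : ℝ} (hb : b ≠ 0) :
    -(1 / b) * b + Real.log (1 / b * (a + b)) + 1 = Real.log (1 + a / b) := by
  have hfactor : 1 / b * (a + b) = 1 + a / b := by field_simp; ring
  rw [hfactor, neg_mul, one_div_mul_cancel hb]
  ring

/-- LFT equivalence for SLqP rate maximization: for nonempty 𝒫 ⊆ ℝ^K,
1 ≤ k ≤ K, and A_i ≥ 0, B_i > 0 on 𝒫, the supremum of f_k of the original rates over 𝒫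
equals the supremum over p ∈ 𝒫 and x ∈ ℝ^K with x_i > 0 of f_k(ř_1(x_1,p),…,ř_K(x_K,p)),
where ř_i(x_i,p) = −x_i B_i(p) + log(x_i(A_i(p) + B_i(p))) + 1; moreover for each fixed p
the inner supremum over x is attained at x_i = 1/B_i(p), where it equals f_k of the
original rates at p. -/
theorem lft_slqp_equivalence (K k : ℕ) (hk1 : 1 ≤ k) (hkK : k ≤ K)
    (P : Set (Fin K → ℝ)) (hP : P.Nonempty)
    (A B : Fin K → (Fin K → ℝ) → ℝ)
    (hA : ∀ i, ∀ p ∈ P, 0 ≤ A i p) (hB : ∀ i, ∀ p ∈ P, 0 < B i p) :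
    sSup {v : ℝ | ∃ p ∈ P,
        v = sumLeast K k (fun i => Real.log (1 + A i p / B i p))}
      = sSup {v : ℝ | ∃ p ∈ P, ∃ x : Fin K → ℝ, (∀ i, 0 < x i) ∧
          v = sumLeast K k (fun i =>
            -(x i) * B i p + Real.log (x i * (A i p + B i p)) + 1)} ∧
    ∀ p ∈ P,
      (∀ i, 0 < 1 / B i p) ∧
      sumLeast K k (fun i =>
          -(1 / B i p) * B i p + Real.log ((1 / B i p) * (A i p + B i p)) + 1)
        = sumLeast K k (fun i => Real.log (1 + A i p / B i p)) ∧
      ∀ x : Fin K → ℝ, (∀ i, 0 < x i) →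
        sumLeast K k (fun i => -(x i) * B i p + Real.log (x i * (A i p + B i p)) + 1)
          ≤ sumLeast K k (fun i => Real.log (1 + A i p / B i p)) := by
  have hattain (p) (hp : p ∈ P) : sumLeast K k (fun i =>
      -(1 / B i p) * B i p + Real.log ((1 / B i p) * (A i p + B i p)) + 1)
        = sumLeast K k (fun i => Real.log (1 + A i p / B i p)) :=
    congrArg (sumLeast K k) <| funext fun i =>
      neg_one_div_mul_add_log_add_one (hB i p hp).ne'
  have hle (p) (hp : p ∈ P) (x : Fin K → ℝ) (hx : ∀ i, 0 < x i) :
      sumLeast K k (fun i => -(x i) * B i p + Real.log (x i * (A i p + B i p)) + 1)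
        ≤ sumLeast K k (fun i => Real.log (1 + A i p / B i p)) :=
    sumLeast_mono K k fun i => neg_mul_add_log_add_one_le (hA i p hp) (hB i p hp) (hx i)
  have hpos (p) (hp : p ∈ P) (i : Fin K) : 0 < 1 / B i p := one_div_pos.mpr (hB i p hp)
  refine ⟨csSup_eq_csSup_of_forall_exists_le ?_ ?_, fun p hp =>
    ⟨hpos p hp, hattain p hp, hle p hp⟩⟩
  · rintro _ ⟨p, hp, rfl⟩
    exact ⟨_, ⟨p, hp, fun i => 1 / B i p, hpos p hp, rfl⟩, (hattain p hp).ge⟩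
  · rintro _ ⟨p, hp, x, hx, rfl⟩
    exact ⟨_, ⟨p, hp, rfl⟩, hle p hp x hx⟩
end

section
/- (Block concavity of the QFT auxiliary objective in the powers.) Fix 1 ≤ k ≤ K, nonnegative constants x_1,…,x_K ≥ 0, channel gains c_i ≥ 0 and cross-channel gains d_{j→i} ≥ 0 (for j ≠ i), and noise power σ² > 0. Define A_i(p) = c_i p_i and B_i(p) = ∑_{j ≠ i} d_{j→i} p_j + σ². Then the function p ↦ f_k( log(1 + 2x_1√(A_1(p)) − x_1² B_1(p)), …, log(1 + 2x_K√(A_K(p)) − x_K² B_K(p)) ) is concave on the convex set of p ∈ ℝ^K with p_i ≥ 0 for all i and 1 + 2x_i√(A_i(p)) − x_i² B_i(p) > 0 for all i. -/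
open Finset in
/-- The sum of the `k` smallest components is at most the sum over any `k` components. -/
theorem sumLeast_le_sum_of_card_eq {K k : ℕ} (hk1 : 1 ≤ k) (hkK : k ≤ K) (x : Fin K → ℝ)
    (s : Finset (Fin K)) (hs : #s = #{i : Fin K | (i : ℕ) < k}) :
    sumLeast K k x ≤ ∑ i ∈ s, x i := by
  set T : Finset (Fin K) := {i : Fin K | (i : ℕ) < k} with hT
  set e := Tuple.sort x
  have hmono : Monotone (x ∘ e) := Tuple.monotone_sort x
  set m : ℝ := x (e ⟨k - 1, by omega⟩)
  have hle : ∀ i ∈ T, x (e i) - m ≤ 0 := fun i hi => sub_nonpos.2 <| hmono <| by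
    simp only [hT, mem_filter, mem_univ, true_and] at hi
    rw [Fin.le_def]
    simp only
    omega
  have hge : ∀ i ∉ T, 0 ≤ x (e i) - m := fun i hi => sub_nonneg.2 <| hmono <| by
    simp only [hT, mem_filter, mem_univ, true_and] at hi
    rw [Fin.le_def]
    simp only
    omega
  set S : Finset (Fin K) := s.map e.symm.toEmbedding with hS
  have hsum : ∑ i ∈ s, x i = ∑ i ∈ S, x (e i) := by simp [hS]
  have hcard : #S = #T := by rw [hS, card_map, hs]
  have key : ∑ i ∈ T, (x (e i) - m) ≤ ∑ i ∈ S, (x (e i) - m) :=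
    calc ∑ i ∈ T, (x (e i) - m)
        ≤ ∑ i ∈ T ∩ S, (x (e i) - m) := by
          rw [← sum_inter_add_sum_sdiff T S]
          have := sum_nonpos (s := T \ S) (f := fun i => x (e i) - m)
            fun i hi => hle i (mem_sdiff.1 hi).1
          linarith
      _ ≤ ∑ i ∈ S, (x (e i) - m) :=
          sum_le_sum_of_subset_of_nonneg inter_subset_right fun i hi hi' =>
            hge i fun h => hi' (mem_inter.2 ⟨h, hi⟩)
  rw [hsum]
  change ∑ i ∈ T, x (e i) ≤ _
  simp only [sum_sub_distrib, sum_const, hcard] at key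
  linarith

open Finset in
/-- The sum of the `k` smallest of finitely many concave functions is concave. -/
theorem concaveOn_sumLeast {E : Type*} [AddCommGroup E] [Module ℝ E] {K k : ℕ} (hk1 : 1 ≤ k)
    (hkK : k ≤ K) {s : Set E} {g : E → Fin K → ℝ} (hg : ∀ i, ConcaveOn ℝ s fun p => g p i) :
    ConcaveOn ℝ s fun p => sumLeast K k (g p) := by
  refine ⟨(hg ⟨0, by omega⟩).1, fun p hp q hq a b ha hb hab => ?_⟩
  set e := Tuple.sort (g (a • p + b • q)) with he
  set S : Finset (Fin K) := ({i : Fin K | (i : ℕ) < k} : Finset (Fin K)).map e.toEmbedding with hS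
  have hcard : #S = #{i : Fin K | (i : ℕ) < k} := card_map _
  have hval : sumLeast K k (g (a • p + b • q)) = ∑ i ∈ S, g (a • p + b • q) i := by
    simp [hS, sumLeast, he]
  have hp' := mul_le_mul_of_nonneg_left (sumLeast_le_sum_of_card_eq hk1 hkK (g p) S hcard) ha
  have hq' := mul_le_mul_of_nonneg_left (sumLeast_le_sum_of_card_eq hk1 hkK (g q) S hcard) hb
  have hsum := sum_le_sum fun i (_ : i ∈ S) => (hg i).2 hp hq ha hb hab
  simp only [smul_eq_mul, sum_add_distrib, ← mul_sum] at hsum ⊢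
  rw [hval]
  linarith

/-- The logarithm of a positive concave function is concave. -/
theorem ConcaveOn.log {E : Type*} [AddCommGroup E] [Module ℝ E] {s : Set E} {h : E → ℝ}
    (hh : ConcaveOn ℝ s h) (hpos : ∀ p ∈ s, 0 < h p) :
    ConcaveOn ℝ s fun p => Real.log (h p) := by
  refine ⟨hh.1, fun p hp q hq a b ha hb hab => ?_⟩
  have hlog := strictConcaveOn_log_Ioi.concaveOn
  exact (hlog.2 (hpos p hp) (hpos q hq) ha hb hab).trans <|
    Real.log_le_log (hlog.1 (hpos p hp) (hpos q hq) ha hb hab) (hh.2 hp hq ha hb hab)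

/-- The argument of the logarithm in the QFT auxiliary objective is concave in the powers. -/
theorem concaveOn_quadratic_transform {ι : Type*} (s : Finset ι) (i : ι) {x c : ℝ}
    (hx : 0 ≤ x) (hc : 0 ≤ c) (d : ι → ℝ) (σ2 : ℝ) :
    ConcaveOn ℝ {p : ι → ℝ | ∀ i, 0 ≤ p i} fun p =>
      1 + 2 * x * Real.sqrt (c * p i) - x ^ 2 * ((∑ j ∈ s, d j * p j) + σ2) := by
  have hconv : Convex ℝ {p : ι → ℝ | ∀ i, 0 ≤ p i} := convex_Ici (0 : ι → ℝ)
  refine ⟨hconv, fun p hp q hq a b ha hb hab => ?_⟩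
  have hsqrt := Real.strictConcaveOn_sqrt.concaveOn.2 (Set.mem_Ici.2 (mul_nonneg hc (hp i)))
    (Set.mem_Ici.2 (mul_nonneg hc (hq i))) ha hb hab
  have hsum : ∑ j ∈ s, d j * (a * p j + b * q j)
      = a * ∑ j ∈ s, d j * p j + b * ∑ j ∈ s, d j * q j := by
    simp only [Finset.mul_sum, ← Finset.sum_add_distrib]
    exact Finset.sum_congr rfl fun j _ => by ring
  have harg : a * (c * p i) + b * (c * q i) = c * (a * p i + b * q i) := by ring
  simp only [smul_eq_mul, Pi.add_apply, Pi.smul_apply, harg, hsum] at hsqrt ⊢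
  have := mul_le_mul_of_nonneg_left hsqrt (mul_nonneg zero_le_two hx)
  obtain rfl : b = 1 - a := by linarith
  linarith

/-- Block concavity of the QFT auxiliary objective in the powers: fix
1 ≤ k ≤ K, auxiliary variables x_i ≥ 0, channel gains c_i ≥ 0, cross gains d_{j→i} ≥ 0
and noise power σ² > 0, and set A_i(p) = c_i p_i, B_i(p) = ∑_{j≠i} d_{j→i} p_j + σ².
Then p ↦ f_k(log(1 + 2x_i√(A_i(p)) − x_i²B_i(p)))_i is concave on the convex set of
nonnegative p with 1 + 2x_i√(A_i(p)) − x_i²B_i(p) > 0 for all i. -/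
theorem qft_auxiliary_block_concave (K k : ℕ) (hk1 : 1 ≤ k) (hkK : k ≤ K)
    (x c : Fin K → ℝ) (hx : ∀ i, 0 ≤ x i) (hc : ∀ i, 0 ≤ c i)
    (d : Fin K → Fin K → ℝ) (hd : ∀ j i, 0 ≤ d j i) (σ2 : ℝ) (hσ2 : 0 < σ2) :
    ConcaveOn ℝ
      {p : Fin K → ℝ | (∀ i, 0 ≤ p i) ∧
        ∀ i, 0 < 1 + 2 * x i * Real.sqrt (c i * p i)
          - (x i) ^ 2 * ((∑ j ∈ Finset.univ.erase i, d j i * p j) + σ2)}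
      (fun p => sumLeast K k (fun i =>
        Real.log (1 + 2 * x i * Real.sqrt (c i * p i)
          - (x i) ^ 2 * ((∑ j ∈ Finset.univ.erase i, d j i * p j) + σ2)))) := by
  have hconc i := concaveOn_quadratic_transform (Finset.univ.erase i) i (hx i) (hc i)
    (fun j => d j i) σ2
  refine concaveOn_sumLeast hk1 hkK fun i => ConcaveOn.log ((hconc i).subset (fun p hp => hp.1) ?_)
    fun p hp => hp.2 i
  intro p hp q hq a b ha hb hab
  exact ⟨(hconc i).1 hp.1 hq.1 ha hb hab, fun j =>
    ((hconc j).convex_gt 0 ⟨hp.1, hp.2 j⟩ ⟨hq.1, hq.2 j⟩ ha hb hab).2⟩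
end
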